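/- arXiv:1210.7324 — 2 statements merged into one kernel-verified Lean document; each statement's English description precedes it below -/
import Mathlib

section
/- Every real local-GL-space has the Mazur–Ulam property: if E is a local-GL-space, then for every real Banach space F, every surjective isometry T : S_E → S_F is the restriction to S_E of a surjective linear isometry from E onto F. -/
open Metric Set

/-- The slice of the closed unit ball determined by a norm-one functional `f` and `ε`:
`S(f, ε) = {x ∈ B_E : f x > 1 - ε}`. -/
def glSlice {E : Type*} [NormedAddCommGroup E] [NormedSpace ℝ E]
    (f : E →L[ℝ] ℝ) (ε : ℝ) : Set E :=
  {x | ‖x‖ ≤ 1 ∧ 1 - ε < f x}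

/-- A (real) Banach space is a generalized-lush space (GL-space) if for every `x` in the
unit sphere and every `ε > 0` there is a norm-one functional `f` with `x ∈ S(f, ε)` and
`dist(y, S(f, ε)) + dist(y, -S(f, ε)) < 2 + ε` for every `y` in the unit sphere. -/
def IsGLSpace (E : Type*) [NormedAddCommGroup E] [NormedSpace ℝ E] : Prop :=
  ∀ x : E, ‖x‖ = 1 → ∀ ε : ℝ, 0 < ε →
    ∃ f : E →L[ℝ] ℝ, ‖f‖ = 1 ∧ x ∈ glSlice f ε ∧
      ∀ y : E, ‖y‖ = 1 →
        infDist y (glSlice f ε) + infDist y (-(glSlice f ε)) < 2 + ε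

/-- A Banach space `E` is a local-GL-space if every separable closed subspace of `E` is
contained in a closed subspace of `E` which, with the induced norm, is a GL-space. -/
def IsLocalGLSpace (E : Type*) [NormedAddCommGroup E] [NormedSpace ℝ E] : Prop :=
  ∀ X : Subspace ℝ E, IsClosed (X : Set E) → TopologicalSpace.SeparableSpace X →
    ∃ Y : Subspace ℝ E, IsClosed (Y : Set E) ∧ X ≤ Y ∧ IsGLSpace Y

/-- `T` restricts to a surjective isometry between the unit spheres of `E` and `F`. -/
structure IsSphereIsometry {E F : Type*} [NormedAddCommGroup E] [NormedAddCommGroup F]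
    (T : E → F) : Prop where
  norm_map : ∀ x : E, ‖x‖ = 1 → ‖T x‖ = 1
  surj : ∀ z : F, ‖z‖ = 1 → ∃ x : E, ‖x‖ = 1 ∧ T x = z
  norm_sub : ∀ x y : E, ‖x‖ = 1 → ‖y‖ = 1 → ‖T x - T y‖ = ‖x - y‖

theorem exists_functional_eq_norm {E : Type*} [NormedAddCommGroup E] [NormedSpace ℝ E] (x : E) :
    ∃ f : E →L[ℝ] ℝ, (∀ w, f w ≤ ‖w‖) ∧ f x = ‖x‖ := by
  obtain ⟨f, hf, hx⟩ := exists_dual_vector'' ℝ x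
  refine ⟨f, fun w => ?_, by simpa using hx⟩
  calc f w ≤ ‖f w‖ := le_abs_self _
    _ ≤ 1 * ‖w‖ := f.le_of_opNorm_le hf w
    _ = ‖w‖ := one_mul _

theorem norm_inv_norm_smul {E : Type*} [NormedAddCommGroup E] [NormedSpace ℝ E] {x : E}
    (hx : x ≠ 0) : ‖‖x‖⁻¹ • x‖ = 1 := by
  rw [norm_smul, norm_inv, norm_norm, inv_mul_cancel₀ (norm_ne_zero_iff.2 hx)]

theorem norm_smul_inv_norm_smul {E : Type*} [NormedAddCommGroup E] [NormedSpace ℝ E] (x : E) :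
    ‖x‖ • ‖x‖⁻¹ • x = x := by
  rcases eq_or_ne x 0 with rfl | hx
  · simp
  · rw [smul_smul, mul_inv_cancel₀ (norm_ne_zero_iff.2 hx), one_smul]

/-- `s` behaves like a sum of `m` unit vectors, among them `T y` and `-T (-y)`, which is
additive for the norm up to `δ`. -/
def IsAlmostAdditive {E F : Type*} [NormedAddCommGroup E] [NormedAddCommGroup F]
    (T : E → F) (y : E) (s : F) (m δ : ℝ) : Prop :=
  ‖s - T y‖ ≤ m - 1 ∧ ‖s + T (-y)‖ ≤ m - 1 ∧ m - δ ≤ ‖s‖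

theorem IsAlmostAdditive.neg_comp_neg {E F : Type*} [NormedAddCommGroup E]
    [NormedAddCommGroup F] {T : E → F} {y : E} {s : F} {m δ : ℝ}
    (h : IsAlmostAdditive T y s m δ) : IsAlmostAdditive (fun x => -T (-x)) y s m δ := by
  refine ⟨?_, ?_, h.2.2⟩
  · simpa using h.2.1
  · simpa [← sub_eq_add_neg] using h.1

theorem IsSphereIsometry.neg_comp_neg {E F : Type*} [NormedAddCommGroup E]
    [NormedAddCommGroup F] {T : E → F} (hT : IsSphereIsometry T) :
    IsSphereIsometry (fun x => -T (-x)) where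
  norm_map x hx := by rw [norm_neg]; exact hT.norm_map _ (by rwa [norm_neg])
  surj z hz := by
    obtain ⟨x, hx, h⟩ := hT.surj (-z) (by rwa [norm_neg])
    exact ⟨-x, by rwa [norm_neg], by rw [neg_neg, h, neg_neg]⟩
  norm_sub x y hx hy := by
    have := hT.norm_sub (-x) (-y) (by rwa [norm_neg]) (by rwa [norm_neg])
    rw [neg_sub_neg, norm_sub_rev, this, neg_sub_neg, norm_sub_rev]

section

variable {E F : Type*} [NormedAddCommGroup E] [NormedSpace ℝ E]
  [NormedAddCommGroup F] [NormedSpace ℝ F] {T : E → F}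

/-- If `a` is a summand of an almost norm-additive sum `b` then `T a` can be added to an almost
norm-additive sum containing the image of the normalization of `b`. -/
theorem IsAlmostAdditive.add_map (hT : IsSphereIsometry T) {a b : E} (ha : ‖a‖ = 1) (hb : b ≠ 0)
    {n η : ℝ} (hbn : n - η ≤ ‖b‖) (hba : ‖b - a‖ ≤ n - 1) {s : F} (hs : s ≠ 0) {m δ : ℝ}
    (hδ : 0 ≤ δ) (hη : 0 ≤ η) (h : IsAlmostAdditive T (‖b‖⁻¹ • b) s m δ) :
    IsAlmostAdditive T (‖b‖⁻¹ • b) (s + T a) (m + 1) (δ + (m + 1) * (η + (n + 1) * δ)) := by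
  have hTa := hT.norm_map a ha
  have hbn' : ‖b‖ ≤ n := by
    have := norm_add_le (b - a) a
    rw [sub_add_cancel] at this
    linarith
  set y := ‖b‖⁻¹ • b with hy
  have hy1 : ‖y‖ = 1 := norm_inv_norm_smul hb
  have hTy := hT.norm_map y hy1
  obtain ⟨h1, h2, h3⟩ := h
  have hsm : ‖s‖ ≤ m := by
    have := norm_add_le (s - T y) (T y)
    rw [sub_add_cancel] at this
    linarith
  have hs0 : 0 < ‖s‖ := norm_pos_iff.2 hs
  have hb0 : 0 < ‖b‖ := norm_pos_iff.2 hb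
  refine ⟨?_, ?_, ?_⟩
  · have := norm_add_le (s - T y) (T a)
    rw [show s + T a - T y = s - T y + T a by abel]
    linarith
  · have := norm_add_le (s + T (-y)) (T a)
    rw [show s + T a + T (-y) = s + T (-y) + T a by abel]
    linarith
  set z := ‖s‖⁻¹ • s with hz
  have hz1 : ‖z‖ = 1 := norm_inv_norm_smul hs
  have hsz : s = ‖s‖ • z := (norm_smul_inv_norm_smul s).symm
  have hby : b = ‖b‖ • y := (norm_smul_inv_norm_smul b).symm
  have hzy : 2 - δ ≤ ‖z + T y‖ := by
    obtain ⟨f, hf, hfs⟩ := exists_functional_eq_norm s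
    have e1 : f z = 1 := by
      rw [hz, map_smul, hfs, smul_eq_mul, inv_mul_cancel₀ hs0.ne']
    have e2 := hf (s - T y)
    have e3 := hf (z + T y)
    rw [map_sub] at e2
    rw [map_add] at e3
    linarith
  obtain ⟨p, hp, hpz⟩ := hT.surj (-z) (by rwa [norm_neg])
  have hdist : ∀ w, ‖w‖ = 1 → ‖w - p‖ = ‖z + T w‖ := fun w hw => by
    rw [← hT.norm_sub w p hw hp, hpz, sub_neg_eq_add, add_comm]
  have hza : 2 - (η + (n + 1) * δ) ≤ ‖z + T a‖ := by
    rw [← hdist a ha]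
    rw [← hdist y hy1] at hzy
    obtain ⟨g, hg, hgy⟩ := exists_functional_eq_norm (y - p)
    have e1 := hg (-p)
    have e2 := hg y
    have e3 := hg (b - a)
    have e4 := hg (a - p)
    have e5 : g b = ‖b‖ * g y := by
      conv_lhs => rw [hby]
      rw [map_smul, smul_eq_mul]
    rw [map_sub] at hgy e3 e4
    rw [map_neg, norm_neg] at e1
    have e6 : ‖b‖ * (1 - δ) ≤ ‖b‖ * g y := by
      apply mul_le_mul_of_nonneg_left _ hb0.le
      linarith
    have e7 : ‖b‖ * δ ≤ n * δ := mul_le_mul_of_nonneg_right hbn' hδ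
    nlinarith
  obtain ⟨k, hk, hkz⟩ := exists_functional_eq_norm (z + T a)
  have e1 := hk z
  have e2 := hk (T a)
  have e3 := hk (s + T a)
  have e4 : k s = ‖s‖ * k z := by
    conv_lhs => rw [hsz]
    rw [map_smul, smul_eq_mul]
  rw [map_add] at hkz e3
  set d := η + (n + 1) * δ with hd
  have hd0 : 0 ≤ d := by
    have : 0 ≤ n := (norm_nonneg b).trans hbn'
    positivity
  have e5 : ‖s‖ * (1 - d) ≤ ‖s‖ * k z := by
    apply mul_le_mul_of_nonneg_left _ hs0.le
    linarith
  have e6 : ‖s‖ * d ≤ m * d := mul_le_mul_of_nonneg_right hsm hd0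
  nlinarith

theorem IsAlmostAdditive.sub_map_neg (hT : IsSphereIsometry T) {a b : E} (ha : ‖a‖ = 1)
    (hb : b ≠ 0) {n η : ℝ} (hbn : n - η ≤ ‖b‖) (hba : ‖b - a‖ ≤ n - 1) {s : F} (hs : s ≠ 0)
    {m δ : ℝ} (hδ : 0 ≤ δ) (hη : 0 ≤ η) (h : IsAlmostAdditive T (‖b‖⁻¹ • b) s m δ) :
    IsAlmostAdditive T (‖b‖⁻¹ • b) (s - T (-a)) (m + 1)
      (δ + (m + 1) * (η + (n + 1) * δ)) := by
  have := (h.neg_comp_neg.add_map hT.neg_comp_neg ha hb hbn hba hs hδ hη).neg_comp_neg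
  simpa [← sub_eq_add_neg] using this

/-- Images of almost norm-additive families under a surjective sphere isometry are almost
supported by a common functional. -/
theorem IsSphereIsometry.exists_functional (hT : IsSphereIsometry T) {u₁ u₂ v₁ v₂ : E}
    (hu₁ : ‖u₁‖ = 1) (hu₂ : ‖u₂‖ = 1) (hv₁ : ‖v₁‖ = 1) (hv₂ : ‖v₂‖ = 1) {ε : ℝ} (hε : 0 ≤ ε)
    (hε' : 1000000 * ε ≤ 1) (h : 4 - 4 * ε ≤ ‖u₁ + u₂ + v₁ + v₂‖) :
    ∃ f : F →L[ℝ] ℝ, (∀ w, f w ≤ ‖w‖) ∧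
      1 - 1000000 * ε ≤ f (T u₁) ∧ 1 - 1000000 * ε ≤ f (T u₂) ∧
      f (T (-v₁)) ≤ -1 + 1000000 * ε ∧ f (T (-v₂)) ≤ -1 + 1000000 * ε := by
  set b := u₁ + u₂ + v₁ + v₂ with hbdef
  have hb : b ≠ 0 := by
    rw [← norm_pos_iff]; linarith
  have three : ∀ p q r : E, ‖p‖ = 1 → ‖q‖ = 1 → ‖r‖ = 1 → ‖p + q + r‖ ≤ 4 - 1 :=
    fun p q r hp hq hr => (norm_add₃_le).trans (by rw [hp, hq, hr]; norm_num)
  have b1 : ‖b - u₁‖ ≤ 4 - 1 := by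
    rw [show b - u₁ = u₂ + v₁ + v₂ by rw [hbdef]; abel]; exact three _ _ _ hu₂ hv₁ hv₂
  have b2 : ‖b - u₂‖ ≤ 4 - 1 := by
    rw [show b - u₂ = u₁ + v₁ + v₂ by rw [hbdef]; abel]; exact three _ _ _ hu₁ hv₁ hv₂
  have b3 : ‖b - v₁‖ ≤ 4 - 1 := by
    rw [show b - v₁ = u₁ + u₂ + v₂ by rw [hbdef]; abel]; exact three _ _ _ hu₁ hu₂ hv₂
  have b4 : ‖b - v₂‖ ≤ 4 - 1 := by
    rw [show b - v₂ = u₁ + u₂ + v₁ by rw [hbdef]; abel]; exact three _ _ _ hu₁ hu₂ hv₁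
  have hy1 : ‖‖b‖⁻¹ • b‖ = 1 := norm_inv_norm_smul hb
  have hη : 0 ≤ 4 * ε := by linarith
  have i0 : IsAlmostAdditive T (‖b‖⁻¹ • b) (T (‖b‖⁻¹ • b) - T (-(‖b‖⁻¹ • b))) 2 0 := by
    generalize ‖b‖⁻¹ • b = y at hy1
    refine ⟨?_, ?_, ?_⟩
    · rw [sub_sub_cancel_left, norm_neg, hT.norm_map _ (by rwa [norm_neg])]; norm_num
    · rw [sub_add_cancel, hT.norm_map _ hy1]; norm_num
    · rw [hT.norm_sub _ _ hy1 (by rwa [norm_neg]), sub_neg_eq_add, ← two_smul ℝ y, norm_smul, hy1]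
      norm_num
  have ne : ∀ {s : F} {m δ : ℝ}, IsAlmostAdditive T (‖b‖⁻¹ • b) s m δ → δ < m → s ≠ 0 := by
    intro s m δ hs hm
    rw [← norm_pos_iff]
    linarith [hs.2.2]
  have i1 := i0.add_map hT hu₁ hb h b1 (ne i0 (by norm_num)) le_rfl hη
  have i2 := i1.add_map hT hu₂ hb h b2 (ne i1 (by linarith)) (by linarith) hη
  have i3 := i2.sub_map_neg hT hv₁ hb h b3 (ne i2 (by linarith)) (by linarith) hη
  have i4 := i3.sub_map_neg hT hv₂ hb h b4 (ne i3 (by linarith)) (by linarith) hη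
  have h6 := i4.2.2
  obtain ⟨f, hf, hfs⟩ := exists_functional_eq_norm
    (T (‖b‖⁻¹ • b) - T (-(‖b‖⁻¹ • b)) + T u₁ + T u₂ - T (-v₁) - T (-v₂))
  have unit : ∀ x : E, ‖x‖ = 1 → f (T x) ≤ 1 ∧ -1 ≤ f (T (-x)) := fun x hx => by
    have e1 := hf (T x)
    have e2 := hf (-T (-x))
    rw [hT.norm_map x hx] at e1
    rw [norm_neg, hT.norm_map (-x) (by rwa [norm_neg]), map_neg] at e2
    exact ⟨e1, by linarith⟩
  rw [← hfs] at h6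
  simp only [map_add, map_sub] at h6
  have := unit _ hy1
  have := unit _ hu₁
  have := unit _ hu₂
  have := unit _ hv₁
  have := unit _ hv₂
  refine ⟨f, hf, ?_, ?_, ?_, ?_⟩ <;> linarith

/-- In a slice with the generalized-lush property, each unit vector is almost metrically between
unit vectors of the slice and of the opposite slice. -/
theorem exists_unit_mem_glSlice {g : E →L[ℝ] ℝ} (hg : ‖g‖ = 1) {ε : ℝ} (hε : ε < 1)
    (hne : (glSlice g ε).Nonempty) {y : E}
    (h : infDist y (glSlice g ε) + infDist y (-(glSlice g ε)) < 2 + ε) :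
    ∃ u v : E, ‖u‖ = 1 ∧ ‖v‖ = 1 ∧ 1 - ε < g u ∧ 1 - ε < g v ∧
      ‖y - u‖ + ‖y + v‖ < 2 + 3 * ε := by
  have hgw : ∀ w, g w ≤ ‖w‖ := fun w =>
    calc g w ≤ ‖g w‖ := le_abs_self _
      _ ≤ 1 * ‖w‖ := g.le_of_opNorm_le hg.le w
      _ = ‖w‖ := one_mul _
  have key : ∀ u ∈ glSlice g ε, ∃ w : E, ‖w‖ = 1 ∧ 1 - ε < g w ∧ ‖u - w‖ < ε := by
    rintro u ⟨hu1, hu2⟩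
    have hu0 : 1 - ε < ‖u‖ := hu2.trans_le (hgw u)
    have hpos : 0 < ‖u‖ := by linarith
    refine ⟨‖u‖⁻¹ • u, norm_inv_norm_smul (norm_pos_iff.1 hpos), ?_, ?_⟩
    · rw [map_smul, smul_eq_mul]
      have : 1 ≤ ‖u‖⁻¹ := (one_le_inv₀ hpos).2 hu1
      nlinarith
    · have : u - ‖u‖⁻¹ • u = (‖u‖ - 1) • (‖u‖⁻¹ • u) := by
        rw [sub_smul, norm_smul_inv_norm_smul, one_smul]
      rw [this, norm_smul, norm_inv_norm_smul (norm_pos_iff.1 hpos), mul_one, Real.norm_eq_abs,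
        abs_lt]
      constructor <;> linarith
  set t := (2 + ε - infDist y (glSlice g ε) - infDist y (-(glSlice g ε))) / 2 with ht
  have ht0 : 0 < t := by rw [ht]; linarith
  obtain ⟨u, hu, hyu⟩ := (infDist_lt_iff hne).1
    (show infDist y (glSlice g ε) < infDist y (glSlice g ε) + t by linarith)
  obtain ⟨v, hv, hyv⟩ := (infDist_lt_iff hne.neg).1
    (show infDist y (-(glSlice g ε)) < infDist y (-(glSlice g ε)) + t by linarith)
  obtain ⟨u', hu1, hu2, hu3⟩ := key u hu
  obtain ⟨v', hv1, hv2, hv3⟩ := key (-v) hv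
  refine ⟨u', v', hu1, hv1, hu2, hv2, ?_⟩
  rw [dist_eq_norm] at hyu hyv
  have e1 := norm_add_le (y - u) (u - u')
  have e2 := norm_sub_le (y - v) (-v - v')
  rw [sub_add_sub_cancel] at e1
  rw [show y - v - (-v - v') = y + v' by abel] at e2
  linarith

/-- On a local-GL-space, the positively homogeneous extension of a surjective sphere isometry does
not decrease distances. -/
theorem IsSphereIsometry.le_norm_smul_sub (hE : IsLocalGLSpace E) (hT : IsSphereIsometry T)
    {x y : E} (hx : ‖x‖ = 1) (hy : ‖y‖ = 1) {α β : ℝ} (hα : 0 ≤ α) (hβ : 0 ≤ β) :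
    ‖α • x - β • y‖ ≤ ‖α • T x - β • T y‖ := by
  rcases eq_or_ne (α • x - β • y) 0 with h0 | h0
  · rw [h0, norm_zero]; exact norm_nonneg _
  let X : Subspace ℝ E := Submodule.span ℝ {x, y}
  have : FiniteDimensional ℝ X := FiniteDimensional.span_of_finite ℝ (Set.toFinite _)
  have : ProperSpace X := FiniteDimensional.proper ℝ X
  obtain ⟨Y, -, hXY, hY⟩ := hE X X.closed_of_finiteDimensional inferInstance
  have hxY : x ∈ Y := hXY (Submodule.subset_span (by simp))
  have hyY : y ∈ Y := hXY (Submodule.subset_span (by simp))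
  set N := ‖α • x - β • y‖ with hN
  have hN0 : 0 < N := norm_pos_iff.2 h0
  let x' : Y := ⟨x, hxY⟩
  let y' : Y := ⟨y, hyY⟩
  have hz0 : α • x' - β • y' ≠ 0 := fun h => h0 (congrArg Subtype.val h)
  have hzN : ‖α • x' - β • y'‖ = N := rfl
  set K := N + (α + β) * 1000004 with hK
  have hK0 : 0 < K := by positivity
  have main : ∀ ε : ℝ, 0 < ε → 1000000 * ε ≤ 1 → N ≤ ‖α • T x - β • T y‖ + K * ε := by
    intro ε hε hε'
    obtain ⟨g, hg, hzg, hgl⟩ := hY _ (norm_inv_norm_smul hz0) ε hε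
    have hgw : ∀ w, g w ≤ ‖w‖ := fun w =>
      calc g w ≤ ‖g w‖ := le_abs_self _
        _ ≤ 1 * ‖w‖ := g.le_of_opNorm_le hg.le w
        _ = ‖w‖ := one_mul _
    obtain ⟨u₁, v₁, hu₁, hv₁, hgu₁, hgv₁, h₁⟩ :=
      exists_unit_mem_glSlice hg (by linarith) ⟨_, hzg⟩ (hgl x' hx)
    obtain ⟨u₂, v₂, hu₂, hv₂, hgu₂, hgv₂, h₂⟩ :=
      exists_unit_mem_glSlice hg (by linarith) ⟨_, hzg⟩ (hgl y' hy)
    have hsum : 4 - 4 * ε ≤ ‖u₁ + u₂ + v₁ + v₂‖ := by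
      have := hgw (u₁ + u₂ + v₁ + v₂)
      simp only [map_add] at this
      linarith
    obtain ⟨f, hf, f1, f2, f3, f4⟩ := hT.exists_functional (u₁ := (u₁ : E)) (u₂ := u₂) (v₁ := v₁)
      (v₂ := v₂) hu₁ hu₂ hv₁ hv₂ hε.le hε' hsum
    have close : ∀ w u v : Y, ‖w‖ = 1 → ‖u‖ = 1 → ‖v‖ = 1 → 1 - ε < g u → 1 - ε < g v →
        ‖w - u‖ + ‖w + v‖ < 2 + 3 * ε → 1 - 1000000 * ε ≤ f (T u) →
        f (T (-v)) ≤ -1 + 1000000 * ε →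
        g w - 1000004 * ε ≤ f (T w) ∧ f (T w) ≤ g w + 1000004 * ε := by
      intro w u v hw hu hv hgu hgv h hfu hfv
      have e1 := hf (T u - T w)
      have e2 := hf (T w - T (-v))
      have e3 := hgw (w + v)
      have e4 := hgw (u - w)
      rw [hT.norm_sub (u : E) (w : E) hu hw] at e1
      rw [hT.norm_sub (w : E) (-(v : E)) hw (by rw [norm_neg]; exact hv), sub_neg_eq_add] at e2
      change _ ≤ ‖u - w‖ at e1
      change _ ≤ ‖w + v‖ at e2
      rw [map_sub, norm_sub_rev] at e1 e4
      rw [map_sub] at e2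
      rw [map_add] at e3
      constructor <;> linarith
    have c1 := (close x' u₁ v₁ hx hu₁ hv₁ hgu₁ hgv₁ h₁ f1 f3).1
    have c2 := (close y' u₂ v₂ hy hu₂ hv₂ hgu₂ hgv₂ h₂ f2 f4).2
    change _ ≤ f (T x) at c1
    change f (T y) ≤ _ at c2
    have hzg2 := hzg.2
    rw [map_smul, smul_eq_mul, hzN, map_sub, map_smul, map_smul, smul_eq_mul, smul_eq_mul,
      inv_mul_eq_div, lt_div_iff₀ hN0] at hzg2
    have e := hf (α • T x - β • T y)
    rw [map_sub, map_smul, map_smul, smul_eq_mul, smul_eq_mul] at e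
    have m1 := mul_le_mul_of_nonneg_left c1 hα
    have m2 := mul_le_mul_of_nonneg_left c2 hβ
    rw [hK]
    nlinarith
  refine le_of_forall_pos_le_add fun t ht => ?_
  have hmin : 0 < min (t / K) (1 / 1000000) := lt_min (div_pos ht hK0) (by norm_num)
  have h1 := main _ hmin (by linarith [min_le_right (t / K) (1 / 1000000)])
  have h2 : K * min (t / K) (1 / 1000000) ≤ t := by
    calc K * min (t / K) (1 / 1000000) ≤ K * (t / K) :=
          mul_le_mul_of_nonneg_left (min_le_left _ _) hK0.le
      _ = t := mul_div_cancel₀ t hK0.ne'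
  linarith

theorem exists_one_le_norm_add_smul_eq {a b : F} (hab : a ≠ b) (h : ‖b‖ ≤ ‖a‖) :
    ∃ t : ℝ, 1 ≤ t ∧ ‖a + t • (b - a)‖ = ‖a‖ := by
  have hd : 0 < ‖b - a‖ := norm_pos_iff.2 (sub_ne_zero.2 hab.symm)
  set R := 1 + 2 * ‖a‖ / ‖b - a‖ with hR
  have hR1 : 1 ≤ R := by rw [hR]; linarith [show 0 ≤ 2 * ‖a‖ / ‖b - a‖ by positivity]
  have hc : ContinuousOn (fun t : ℝ => ‖a + t • (b - a)‖) (Icc 1 R) := by fun_prop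
  obtain ⟨t, ht, hta⟩ := intermediate_value_Icc hR1 hc (show ‖a‖ ∈ Icc _ _ by
    constructor
    · simpa using h
    · have e := norm_sub_le (a + R • (b - a)) a
      rw [add_sub_cancel_left, norm_smul, Real.norm_of_nonneg (by linarith), hR, add_mul, one_mul,
        div_mul_cancel₀ _ hd.ne'] at e
      change _ ≤ ‖a + R • (b - a)‖
      rw [hR]
      linarith)
  exact ⟨t, ht.1, hta⟩

end

/-- A surjective norm-preserving map which does not decrease distances and is isometric on
centred spheres is an isometry. -/
theorem norm_sub_eq_of_expansive {E F : Type*} [NormedAddCommGroup E]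
    [NormedAddCommGroup F] [NormedSpace ℝ F] {U : E → F} (hU : Function.Surjective U)
    (hnorm : ∀ x, ‖U x‖ = ‖x‖) (hexp : ∀ x y, ‖x - y‖ ≤ ‖U x - U y‖)
    (hsph : ∀ x y, ‖x‖ = ‖y‖ → ‖U x - U y‖ = ‖x - y‖) (x y : E) :
    ‖U x - U y‖ = ‖x - y‖ := by
  wlog h : ‖y‖ ≤ ‖x‖ generalizing x y
  · rw [norm_sub_rev, norm_sub_rev x]; exact this y x (le_of_not_ge h)
  rcases eq_or_ne (U x) (U y) with hxy | hxy
  · have := hexp x y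
    rw [hxy, sub_self, norm_zero] at this ⊢
    exact (norm_nonneg _).antisymm this
  obtain ⟨t, ht, hc⟩ := exists_one_le_norm_add_smul_eq hxy (by rwa [hnorm, hnorm])
  obtain ⟨w, hw⟩ := hU (U x + t • (U y - U x))
  have e1 : ‖x‖ = ‖w‖ := by rw [← hnorm w, hw, hc, hnorm]
  have e2 := hsph x w e1
  have e3 := hexp y w
  have e4 := norm_sub_le_norm_sub_add_norm_sub x y w
  have e5 : ‖U x - U w‖ = t * ‖U x - U y‖ := by
    rw [hw, sub_add_cancel_left, norm_neg, norm_smul, Real.norm_of_nonneg (by linarith),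
      norm_sub_rev]
  have e6 : ‖U y - U w‖ = (t - 1) * ‖U x - U y‖ := by
    rw [hw, show U y - (U x + t • (U y - U x)) = (t - 1) • (U x - U y) by module, norm_smul,
      Real.norm_of_nonneg (by linarith)]
  have e7 := hexp x y
  linarith

/-- Theorem 3.7: every local-GL-space has the Mazur–Ulam property: for every Banach space
`F`, every surjective isometry `T : S_E → S_F` extends to a surjective linear isometry
`E ≃ F`. -/
theorem stmt_15 {E F : Type*} [NormedAddCommGroup E] [NormedSpace ℝ E] [CompleteSpace E]
    [NormedAddCommGroup F] [NormedSpace ℝ F] [CompleteSpace F]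
    (hE : IsLocalGLSpace E) (T : E → F)
    (hmap : ∀ x : E, ‖x‖ = 1 → ‖T x‖ = 1)
    (hsurj : ∀ z : F, ‖z‖ = 1 → ∃ x : E, ‖x‖ = 1 ∧ T x = z)
    (hiso : ∀ x y : E, ‖x‖ = 1 → ‖y‖ = 1 → ‖T x - T y‖ = ‖x - y‖) :
    ∃ L : E ≃ₗᵢ[ℝ] F, ∀ x : E, ‖x‖ = 1 → L x = T x := by
  have hT : IsSphereIsometry T := ⟨hmap, hsurj, hiso⟩
  let U : E → F := fun x => ‖x‖ • T (‖x‖⁻¹ • x)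
  have hU1 : ∀ x : E, ‖x‖ = 1 → U x = T x := fun x hx => by simp [U, hx]
  have hU0 : U 0 = 0 := by simp [U]
  have hnorm : ∀ x, ‖U x‖ = ‖x‖ := fun x => by
    rcases eq_or_ne x 0 with rfl | hx
    · simp [U]
    · simp only [U]
      rw [norm_smul, norm_norm, hmap _ (norm_inv_norm_smul hx), mul_one]
  have hsmul : ∀ (r : ℝ) (x : E), 0 < r → ‖x‖ = 1 → U (r • x) = r • T x := fun r x hr hx => by
    simp only [U]
    rw [norm_smul, hx, mul_one, Real.norm_of_nonneg hr.le, smul_smul, inv_mul_cancel₀ hr.ne',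
      one_smul]
  have hsurjU : Function.Surjective U := fun z => by
    rcases eq_or_ne z 0 with rfl | hz
    · exact ⟨0, hU0⟩
    · obtain ⟨x, hx, hxz⟩ := hsurj _ (norm_inv_norm_smul hz)
      exact ⟨‖z‖ • x, by rw [hsmul _ _ (norm_pos_iff.2 hz) hx, hxz, norm_smul_inv_norm_smul]⟩
  have hexp : ∀ x y, ‖x - y‖ ≤ ‖U x - U y‖ := fun x y => by
    rcases eq_or_ne x 0 with rfl | hx
    · rw [hU0, zero_sub, zero_sub, norm_neg, norm_neg, hnorm]
    rcases eq_or_ne y 0 with rfl | hy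
    · rw [hU0, sub_zero, sub_zero, hnorm]
    have := hT.le_norm_smul_sub hE (norm_inv_norm_smul hx) (norm_inv_norm_smul hy)
      (norm_nonneg x) (norm_nonneg y)
    rwa [norm_smul_inv_norm_smul, norm_smul_inv_norm_smul] at this
  have hsph : ∀ x y, ‖x‖ = ‖y‖ → ‖U x - U y‖ = ‖x - y‖ := fun x y hxy => by
    rcases eq_or_ne x 0 with rfl | hx
    · rw [hU0, zero_sub, zero_sub, norm_neg, norm_neg, hnorm]
    have hy : y ≠ 0 := norm_ne_zero_iff.1 (hxy ▸ norm_ne_zero_iff.2 hx)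
    simp only [U]
    rw [← hxy, ← smul_sub, norm_smul, hiso _ _ (norm_inv_norm_smul hx)
      (hxy ▸ norm_inv_norm_smul hy), ← norm_smul, smul_sub, norm_smul_inv_norm_smul, hxy,
      norm_smul_inv_norm_smul]
  have hisoU : Isometry U := Isometry.of_dist_eq fun x y => by
    rw [dist_eq_norm, dist_eq_norm, norm_sub_eq_of_expansive hsurjU hnorm hexp hsph]
  let e : E ≃ᵢ F := ⟨Equiv.ofBijective U ⟨hisoU.injective, hsurjU⟩, hisoU⟩
  exact ⟨e.toRealLinearIsometryEquivOfMapZero hU0, hU1⟩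
end

section
/- Every real lush space has the Mazur–Ulam property: if E is lush, then for every real Banach space F, every surjective isometry T : S_E → S_F is the restriction to S_E of a surjective linear isometry from E onto F. -/
open Metric Set

/-- A (real) Banach space is lush if for all `x, y` in the unit sphere and `ε > 0` there is
a norm-one functional `f` with `x ∈ S(f, ε)` and `dist(y, aco S(f, ε)) < ε`, where in the
real case `aco S = co (S ∪ -S)`. -/
def IsLush (E : Type*) [NormedAddCommGroup E] [NormedSpace ℝ E] : Prop :=
  ∀ x y : E, ‖x‖ = 1 → ‖y‖ = 1 → ∀ ε : ℝ, 0 < ε →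
    ∃ f : E →L[ℝ] ℝ, ‖f‖ = 1 ∧ x ∈ glSlice f ε ∧
      infDist y (convexHull ℝ (glSlice f ε ∪ -(glSlice f ε))) < ε

section SphereIsometry

variable {E F : Type*} [NormedAddCommGroup E] [NormedAddCommGroup F]

/-- Mutually inverse isometries between the unit spheres of two normed spaces. -/
structure IsSphereIsometry_s16 (T : E → F) (R : F → E) : Prop where
  norm_map : ∀ x, ‖x‖ = 1 → ‖T x‖ = 1
  norm_inv : ∀ z, ‖z‖ = 1 → ‖R z‖ = 1
  left_inv : ∀ x, ‖x‖ = 1 → R (T x) = x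
  right_inv : ∀ z, ‖z‖ = 1 → T (R z) = z
  norm_sub : ∀ x y, ‖x‖ = 1 → ‖y‖ = 1 → ‖T x - T y‖ = ‖x - y‖

theorem IsSphereIsometry_s16.symm {T : E → F} {R : F → E} (h : IsSphereIsometry_s16 T R) :
    IsSphereIsometry_s16 R T where
  norm_map := h.norm_inv
  norm_inv := h.norm_map
  left_inv := h.right_inv
  right_inv := h.left_inv
  norm_sub x y hx hy := by
    rw [← h.norm_sub _ _ (h.norm_inv x hx) (h.norm_inv y hy), h.right_inv x hx, h.right_inv y hy]

theorem norm_list_sum_le_length (l : List E) (hl : ∀ b ∈ l, ‖b‖ ≤ 1) : ‖l.sum‖ ≤ l.length := by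
  induction l with
  | nil => simp
  | cons b l ih =>
    have h1 := ih fun c hc => hl c (List.mem_cons_of_mem _ hc)
    have h2 := hl b List.mem_cons_self
    have h3 := norm_add_le b l.sum
    simp only [List.sum_cons, List.length_cons, Nat.cast_add, Nat.cast_one]
    linarith

variable [NormedSpace ℝ E] [NormedSpace ℝ F]

theorem norm_inv_smul_self_eq_one {v : E} (hv : v ≠ 0) : ‖‖v‖⁻¹ • v‖ = 1 := by
  rw [norm_smul, norm_inv, norm_norm, inv_mul_cancel₀ (norm_ne_zero_iff.mpr hv)]

theorem norm_smul_normalize_sub {v : E} (hv : v ≠ 0) (K : ℝ) :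
    ‖K • (‖v‖⁻¹ • v) - v‖ = |K - ‖v‖| := by
  have hv' : ‖v‖ ≠ 0 := norm_ne_zero_iff.mpr hv
  have : K • (‖v‖⁻¹ • v) - v = (K - ‖v‖) • (‖v‖⁻¹ • v) := by
    rw [sub_smul, smul_smul ‖v‖, mul_inv_cancel₀ hv', one_smul]
  rw [this, norm_smul, norm_inv_smul_self_eq_one hv, mul_one, Real.norm_eq_abs]

/-- A functional of norm at most one attaining the norm of a given vector. -/
theorem exists_norming_functional (v : E) :
    ∃ g : E →L[ℝ] ℝ, (∀ x, g x ≤ ‖x‖) ∧ g v = ‖v‖ := by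
  obtain ⟨g, hg, hv⟩ := exists_dual_vector'' ℝ v
  refine ⟨g, fun x => ?_, by simpa using hv⟩
  have := g.le_of_opNorm_le hg x
  exact (le_abs_self _).trans (by simpa using this)

/-- Almost aligned unit vectors are sent to almost aligned unit vectors. -/
theorem IsSphereIsometry_s16.norm_add_ge {T : E → F} {R : F → E} (h : IsSphereIsometry_s16 T R)
    {s : ℝ} (hs : 0 < s) (hs' : s ≤ 1 / 2) {u v : E} (hu : ‖u‖ = 1) (hv : ‖v‖ = 1)
    (huv : 2 - s ^ 2 ≤ ‖u + v‖) : 2 - 4 * s ≤ ‖T u + T v‖ := by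
  set W : E := s • u + (1 - s) • v with hW
  have hcW : ‖(1 - s) • u + s • v‖ ≤ 1 := by
    refine (norm_add_le _ _).trans ?_
    rw [norm_smul, norm_smul, hu, hv, Real.norm_of_nonneg hs.le,
      Real.norm_of_nonneg (by linarith)]
    linarith
  have hW1 : 1 - s ^ 2 ≤ ‖W‖ := by
    have : u + v = W + ((1 - s) • u + s • v) := by rw [hW]; module
    have h2 := norm_add_le W ((1 - s) • u + s • v)
    rw [← this] at h2
    linarith
  have hW2 : ‖W‖ ≤ 1 := by
    refine (norm_add_le _ _).trans ?_
    rw [norm_smul, norm_smul, hu, hv, Real.norm_of_nonneg hs.le,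
      Real.norm_of_nonneg (by linarith)]
    linarith
  have hW0 : W ≠ 0 := by
    rw [← norm_ne_zero_iff]
    nlinarith
  set w : E := ‖W‖⁻¹ • W with hw
  have hw1 : ‖w‖ = 1 := norm_inv_smul_self_eq_one hW0
  have hwW : ‖w - W‖ ≤ s ^ 2 := by
    have := norm_smul_normalize_sub hW0 1
    rw [one_smul, abs_of_nonneg (by linarith)] at this
    rw [this]; linarith
  have hTw := h.norm_map w hw1
  have hnTw : ‖-T w‖ = 1 := by rw [norm_neg, hTw]
  set p : E := R (-T w) with hp
  have hp1 : ‖p‖ = 1 := h.norm_inv _ hnTw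
  have hTp : T p = -T w := h.right_inv _ hnTw
  have hwp : ‖w - p‖ = 2 := by
    rw [← h.norm_sub w p hw1 hp1, hTp, sub_neg_eq_add, ← two_smul ℝ, norm_smul, hTw]
    norm_num
  have hup : 2 * s - s ^ 2 ≤ s * ‖u - p‖ := by
    have e : w - p = (w - W) + (s • (u - p) + (1 - s) • (v - p)) := by rw [hW]; module
    have h1 := norm_add_le (w - W) (s • (u - p) + (1 - s) • (v - p))
    have h2 := norm_add_le (s • (u - p)) ((1 - s) • (v - p))
    have h3 : ‖v - p‖ ≤ 2 := (norm_sub_le _ _).trans (by linarith)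
    rw [← e, hwp] at h1
    rw [norm_smul, norm_smul, Real.norm_of_nonneg hs.le, Real.norm_of_nonneg (by linarith)] at h2
    nlinarith
  have hup' : 2 - s ≤ ‖u - p‖ := by
    have : s * (2 - s) ≤ s * ‖u - p‖ := by linarith
    exact le_of_mul_le_mul_left this hs
  have huw : 2 - s ≤ ‖T u + T w‖ := by
    rwa [← h.norm_sub u p hu hp1, hTp, sub_neg_eq_add] at hup'
  have hwv : ‖w - v‖ ≤ s ^ 2 + 2 * s := by
    have e : w - v = (w - W) + s • (u - v) := by rw [hW]; module
    have h1 := norm_add_le (w - W) (s • (u - v))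
    have h3 : ‖u - v‖ ≤ 2 := (norm_sub_le _ _).trans (by linarith)
    rw [norm_smul, Real.norm_of_nonneg hs.le] at h1
    rw [e]
    nlinarith
  have e : T u + T w = (T u + T v) + (T w - T v) := by abel
  have h1 := norm_add_le (T u + T v) (T w - T v)
  rw [← e, h.norm_sub w v hw1 hv] at h1
  nlinarith

/-- If `N • w` is almost `u` plus a vector of norm at most `N - 1`, then whatever is almost aligned
with `w` is almost aligned with `u`. -/
theorem norm_add_ge_of_norm_smul_sub_le {w u m : E} {N δ η : ℝ} (hN : 1 ≤ N) (hm : ‖m‖ = 1)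
    (hwu : ‖N • w - u‖ ≤ N - 1 + δ) (hmw : 2 - η ≤ ‖m + w‖) :
    2 - (N * η + δ) ≤ ‖m + u‖ := by
  have e : N • (m + w) = (m + u) + (N - 1) • m + (N • w - u) := by module
  have h1 := norm_add₃_le (a := m + u) (b := (N - 1) • m) (c := N • w - u)
  rw [← e, norm_smul, norm_smul, hm, Real.norm_of_nonneg (by linarith),
    Real.norm_of_nonneg (by linarith)] at h1
  nlinarith

theorem IsSphereIsometry_s16.norm_add_ge_of_aligned {T : E → F} {R : F → E}
    (h : IsSphereIsometry_s16 T R) {N K ε : ℝ} (hN : 1 ≤ N) (hK : 1 ≤ K) (hε : 0 < ε) :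
    ∃ δ > 0, ∀ (w u : E) (V b : F), ‖w‖ = 1 → ‖u‖ = 1 → ‖N • w - u‖ ≤ N - 1 + δ →
      K - δ ≤ ‖V‖ → ‖V - T w‖ ≤ K - 1 → (b = T u ∨ b = -T (-u)) → K + 1 - ε ≤ ‖V + b‖ := by
  obtain ⟨τ, hτ, hτ1, hτ2⟩ : ∃ τ : ℝ, 0 < τ ∧ τ ≤ 1 / 2 ∧ 8 * K * τ ≤ ε := by
    refine ⟨min (1 / 2) (ε / (8 * K)), by positivity, min_le_left _ _, ?_⟩
    have := min_le_right (1 / 2) (ε / (8 * K))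
    rwa [le_div_iff₀' (by positivity)] at this
  obtain ⟨σ, hσ, hσ1, hσ2⟩ : ∃ σ : ℝ, 0 < σ ∧ σ ≤ 1 / 2 ∧ 8 * N * σ ≤ τ ^ 2 := by
    refine ⟨min (1 / 2) (τ ^ 2 / (8 * N)), by positivity, min_le_left _ _, ?_⟩
    have := min_le_right (1 / 2) (τ ^ 2 / (8 * N))
    rwa [le_div_iff₀' (by positivity)] at this
  obtain ⟨δ, hδ, hδ1, hδ2, hδ3, hδ4⟩ : ∃ δ : ℝ, 0 < δ ∧ δ ≤ σ ^ 2 / 3 ∧ δ ≤ τ ^ 2 / 2 ∧ δ ≤ ε / 2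
      ∧ δ ≤ 1 / 2 := by
    refine ⟨min (min (σ ^ 2 / 3) (τ ^ 2 / 2)) (min (ε / 2) (1 / 2)), by positivity, ?_, ?_, ?_, ?_⟩
    · exact (min_le_left _ _).trans (min_le_left _ _)
    · exact (min_le_left _ _).trans (min_le_right _ _)
    · exact (min_le_right _ _).trans (min_le_left _ _)
    · exact (min_le_right _ _).trans (min_le_right _ _)
  refine ⟨δ, hδ, fun w u V b hw hu hwu hV hVw hb => ?_⟩
  have hTw := h.norm_map w hw
  have hnu : ‖-u‖ = 1 := by rw [norm_neg, hu]
  have hb1 : ‖b‖ = 1 := by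
    rcases hb with rfl | rfl
    · exact h.norm_map u hu
    · rw [norm_neg]; exact h.norm_map _ hnu
  have hVK : ‖V‖ ≤ K := by
    have := norm_add_le (V - T w) (T w)
    rw [sub_add_cancel] at this
    linarith
  have hV0 : V ≠ 0 := by
    rw [← norm_ne_zero_iff]
    linarith
  set a : F := ‖V‖⁻¹ • V with ha
  have ha1 : ‖a‖ = 1 := norm_inv_smul_self_eq_one hV0
  have haV : ‖K • a - V‖ ≤ δ := by
    rw [ha, norm_smul_normalize_sub hV0, abs_of_nonneg (by linarith)]
    linarith
  have haw : 2 - σ ^ 2 ≤ ‖a + T w‖ := by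
    have e : (K + 1) • V = K • (a + T w) - (K • a - V) + K • (V - T w) := by module
    have h1 := norm_add_le (K • (a + T w) - (K • a - V)) (K • (V - T w))
    have h2 := norm_sub_le (K • (a + T w)) (K • a - V)
    rw [← e] at h1
    simp only [norm_smul, Real.norm_of_nonneg (show (0 : ℝ) ≤ K by linarith),
      Real.norm_of_nonneg (show (0 : ℝ) ≤ K + 1 by linarith)] at h1 h2
    have h3 : K * (2 - 3 * δ) ≤ K * ‖a + T w‖ := by nlinarith
    have h4 := le_of_mul_le_mul_left h3 (by linarith)
    linarith
  set m : E := R a with hm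
  have hm1 : ‖m‖ = 1 := h.norm_inv a ha1
  have hTm : T m = a := h.right_inv a ha1
  have hmw : 2 - 4 * σ ≤ ‖m + w‖ := by
    have := h.symm.norm_add_ge hσ hσ1 ha1 hTw haw
    rwa [h.left_inv w hw] at this
  have hmu : 2 - τ ^ 2 ≤ ‖m + u‖ := by
    have := norm_add_ge_of_norm_smul_sub_le hN hm1 hwu hmw
    linarith
  have hab : 2 - 4 * τ ≤ ‖a + b‖ := by
    rcases hb with rfl | rfl
    · rw [← hTm]
      exact h.norm_add_ge hτ hτ1 hm1 hu hmu
    · rw [← sub_eq_add_neg, ← hTm, h.norm_sub m (-u) hm1 hnu, sub_neg_eq_add]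
      nlinarith
  have e : K • (a + b) = (V + b) + (K • a - V) + (K - 1) • b := by module
  have h1 := norm_add₃_le (a := V + b) (b := K • a - V) (c := (K - 1) • b)
  rw [← e, norm_smul, norm_smul, hb1, Real.norm_of_nonneg (by linarith),
    Real.norm_of_nonneg (by linarith)] at h1
  nlinarith

theorem apply_list_sum_le (g : E →L[ℝ] ℝ) (hg : ∀ x, g x ≤ ‖x‖) (l : List E)
    (hl : ∀ b ∈ l, ‖b‖ ≤ 1) {b : E} (hb : b ∈ l) : g l.sum ≤ g b + l.length - 1 := by
  induction l with
  | nil => simp at hb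
  | cons c l ih =>
    have hl' : ∀ b ∈ l, ‖b‖ ≤ 1 := fun d hd => hl d (List.mem_cons_of_mem _ hd)
    simp only [List.sum_cons, List.length_cons, Nat.cast_add, Nat.cast_one, map_add]
    rcases List.mem_cons.mp hb with rfl | hb
    · have := (hg l.sum).trans (norm_list_sum_le_length l hl')
      linarith
    · have h1 := ih hl' hb
      have h2 := (hg c).trans (hl c List.mem_cons_self)
      linarith

theorem IsSphereIsometry_s16.norm_add_list_sum_ge {T : E → F} {R : F → E}
    (h : IsSphereIsometry_s16 T R) {N : ℝ} (hN : 1 ≤ N) (k : ℕ) :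
    ∀ {ε : ℝ}, 0 < ε → ∃ δ > 0, ∀ (w : E) (l : List F), ‖w‖ = 1 → l.length = k →
      (∀ b ∈ l, ∃ u, ‖u‖ = 1 ∧ ‖N • w - u‖ ≤ N - 1 + δ ∧ (b = T u ∨ b = -T (-u))) →
      k + 1 - ε ≤ ‖T w + l.sum‖ := by
  induction k with
  | zero =>
    intro ε hε
    refine ⟨1, one_pos, fun w l hw hl _ => ?_⟩
    obtain rfl := List.length_eq_zero_iff.mp hl
    simp [h.norm_map w hw, hε.le]
  | succ k ih =>
    intro ε hε
    obtain ⟨δ₁, hδ₁, h₁⟩ := h.norm_add_ge_of_aligned hN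
      (show (1 : ℝ) ≤ k + 1 by linarith [k.cast_nonneg (α := ℝ)]) hε
    obtain ⟨δ₂, hδ₂, h₂⟩ := ih hδ₁
    refine ⟨min δ₁ δ₂, lt_min hδ₁ hδ₂, fun w l hw hl hb => ?_⟩
    cases l with
    | nil => simp at hl
    | cons b l =>
      have hl' : l.length = k := by simpa using hl
      have hb' : ∀ c ∈ l, ‖c‖ ≤ 1 := fun c hc => by
        obtain ⟨u, hu, -, rfl | rfl⟩ := hb c (List.mem_cons_of_mem _ hc)
        · exact (h.norm_map u hu).le
        · rw [norm_neg]; exact (h.norm_map _ (by rw [norm_neg, hu])).le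
      have hV := h₂ w l hw hl' fun c hc => by
        obtain ⟨u, hu, hwu, hc⟩ := hb c (List.mem_cons_of_mem _ hc)
        exact ⟨u, hu, by linarith [min_le_right δ₁ δ₂], hc⟩
      obtain ⟨u, hu, hwu, hbu⟩ := hb b List.mem_cons_self
      have hs := norm_list_sum_le_length l hb'
      rw [hl'] at hs
      have := h₁ w u (T w + l.sum) b hw hu (by linarith [min_le_left δ₁ δ₂]) hV
        (by rw [add_sub_cancel_left]; linarith) hbu
      rw [List.sum_cons, add_comm b, ← add_assoc]
      push_cast
      exact this

theorem IsSphereIsometry_s16.exists_functional {T : E → F} {R : F → E}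
    (h : IsSphereIsometry_s16 T R) {N : ℝ} (hN : 1 ≤ N) (k : ℕ) {ε : ℝ} (hε : 0 < ε) :
    ∃ δ > 0, ∀ (w : E) (l : List F), ‖w‖ = 1 → l.length = k →
      (∀ b ∈ l, ∃ u, ‖u‖ = 1 ∧ ‖N • w - u‖ ≤ N - 1 + δ ∧ (b = T u ∨ b = -T (-u))) →
      ∃ f : F →L[ℝ] ℝ, (∀ x, f x ≤ ‖x‖) ∧ ∀ b ∈ l, 1 - ε ≤ f b := by
  obtain ⟨δ, hδ, H⟩ := h.norm_add_list_sum_ge hN k hε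
  refine ⟨δ, hδ, fun w l hw hl hb => ?_⟩
  obtain ⟨f, hf, hfV⟩ := exists_norming_functional (T w + l.sum)
  refine ⟨f, hf, fun b hbl => ?_⟩
  have hb' : ∀ c ∈ l, ‖c‖ ≤ 1 := fun c hc => by
    obtain ⟨u, hu, -, rfl | rfl⟩ := hb c hc
    · exact (h.norm_map u hu).le
    · rw [norm_neg]; exact (h.norm_map _ (by rw [norm_neg, hu])).le
  have h1 := H w l hw hl hb
  have h2 := apply_list_sum_le f hf l hb' hbl
  have h3 := hf (T w)
  rw [h.norm_map w hw] at h3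
  rw [← hfV, map_add] at h1
  rw [hl] at h2
  linarith

end SphereIsometry

section Lush

variable {E F : Type*} [NormedAddCommGroup E] [NormedSpace ℝ E]
  [NormedAddCommGroup F] [NormedSpace ℝ F]

theorem convex_glSlice (f : E →L[ℝ] ℝ) (ε : ℝ) : Convex ℝ (glSlice f ε) := by
  have : glSlice f ε = closedBall 0 1 ∩ {x | 1 - ε < f x} := by
    ext x; simp [glSlice]
  rw [this]
  exact (convex_closedBall _ _).inter (convex_halfSpace_gt f.isLinear _)

/-- A slice point may be replaced by a nearby unit vector in the slice. -/
theorem exists_unit_of_mem_glSlice {f : E →L[ℝ] ℝ} (hf : ∀ x, f x ≤ ‖x‖) {ε : ℝ} (hε : ε ≤ 1)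
    {p : E} (hp : p ∈ glSlice f ε) : ∃ s, ‖s‖ = 1 ∧ 1 - ε ≤ f s ∧ ‖s - p‖ ≤ ε := by
  obtain ⟨hp1, hp2⟩ := hp
  have hfp := hf p
  have hp0 : 0 < ‖p‖ := by linarith
  have hp0' : p ≠ 0 := norm_pos_iff.mp hp0
  refine ⟨‖p‖⁻¹ • p, norm_inv_smul_self_eq_one hp0', ?_, ?_⟩
  · rw [map_smul, smul_eq_mul, ← div_eq_inv_mul, le_div_iff₀ hp0]
    nlinarith
  · have := norm_smul_normalize_sub hp0' 1
    rw [one_smul, abs_of_nonneg (by linarith)] at this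
    rw [this]
    linarith

theorem IsLush.exists_unit_decomposition (hE : IsLush E) {x y : E} (hx : ‖x‖ = 1) (hy : ‖y‖ = 1)
    {ε : ℝ} (hε : 0 < ε) : ∃ s s' : E, ∃ t : ℝ, ‖s‖ = 1 ∧ ‖s'‖ = 1 ∧ 0 ≤ t ∧ t ≤ 1 ∧
      3 - ε ≤ ‖x + s + s'‖ ∧ ‖y - (t • s - (1 - t) • s')‖ ≤ ε := by
  obtain ⟨η, hη, hη1, hηε⟩ : ∃ η : ℝ, 0 < η ∧ η ≤ 1 ∧ 3 * η ≤ ε := by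
    refine ⟨min 1 (ε / 3), by positivity, min_le_left _ _, ?_⟩
    linarith [min_le_right 1 (ε / 3)]
  obtain ⟨f, hf, hxf, hdist⟩ := hE x y hx hy η hη
  have hf' : ∀ v, f v ≤ ‖v‖ := fun v =>
    (le_abs_self _).trans (by simpa using f.le_of_opNorm_le hf.le v)
  have hne : (glSlice f η).Nonempty := ⟨x, hxf⟩
  rw [infDist_lt_iff ((hne.mono subset_union_left).convexHull)] at hdist
  obtain ⟨y', hy', hd⟩ := hdist
  rw [convexHull_union hne hne.neg, (convex_glSlice f η).convexHull_eq,
    (convex_glSlice f η).neg.convexHull_eq, mem_convexJoin] at hy'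
  obtain ⟨p, hp, q, hq, a, b, ha, hb, hab, rfl⟩ := hy'
  obtain ⟨s, hs1, hsf, hsp⟩ := exists_unit_of_mem_glSlice hf' hη1 hp
  obtain ⟨s', hs'1, hs'f, hs'q⟩ := exists_unit_of_mem_glSlice hf' hη1 (Set.mem_neg.mp hq)
  obtain rfl : b = 1 - a := by linarith
  refine ⟨s, s', a, hs1, hs'1, ha, by linarith, ?_, ?_⟩
  · have h1 := hf' (x + s + s')
    rw [map_add, map_add] at h1
    linarith [hxf.2]
  · have e : y - (a • s - (1 - a) • s') =
        (y - (a • p + (1 - a) • q)) - a • (s - p) + (1 - a) • (s' - -q) := by module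
    rw [dist_eq_norm] at hd
    have h1 := norm_add_le ((y - (a • p + (1 - a) • q)) - a • (s - p)) ((1 - a) • (s' - -q))
    have h2 := norm_sub_le (y - (a • p + (1 - a) • q)) (a • (s - p))
    rw [norm_smul, Real.norm_of_nonneg hb] at h1
    rw [norm_smul, Real.norm_of_nonneg ha] at h2
    rw [e]
    nlinarith

/-- A finite family of unit vectors of a lush space decomposes, up to `ε`, along a single slice. -/
theorem IsLush.exists_common_decomposition (hE : IsLush E) (ys : List E) :
    (∀ y ∈ ys, ‖y‖ = 1) → ∀ x : E, ‖x‖ = 1 → ∀ ε : ℝ, 0 < ε → ∃ w : E, ‖w‖ = 1 ∧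
      ‖(3 ^ ys.length : ℝ) • w - x‖ ≤ 3 ^ ys.length - 1 + ε ∧
      ∀ y ∈ ys, ∃ s s' : E, ∃ t : ℝ, ‖s‖ = 1 ∧ ‖s'‖ = 1 ∧ 0 ≤ t ∧ t ≤ 1 ∧
        ‖(3 ^ ys.length : ℝ) • w - s‖ ≤ 3 ^ ys.length - 1 + ε ∧
        ‖(3 ^ ys.length : ℝ) • w - s'‖ ≤ 3 ^ ys.length - 1 + ε ∧
        ‖y - (t • s - (1 - t) • s')‖ ≤ ε := by
  induction ys with
  | nil =>
    intro _ x hx ε hε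
    exact ⟨x, hx, by simp [hε.le], by simp⟩
  | cons y ys ih =>
    intro hys x hx ε hε
    obtain ⟨η, hη, hη1, hηε⟩ : ∃ η : ℝ, 0 < η ∧ η ≤ 1 ∧ 4 * η ≤ ε := by
      refine ⟨min 1 (ε / 4), by positivity, min_le_left _ _, ?_⟩
      linarith [min_le_right 1 (ε / 4)]
    obtain ⟨s, s', t, hs, hs', ht, ht', hsum, hyt⟩ :=
      hE.exists_unit_decomposition hx (hys y List.mem_cons_self) hη
    set V := x + s + s' with hV
    have hV3 : ‖V‖ ≤ 3 := by
      have := norm_add₃_le (a := x) (b := s) (c := s')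
      linarith
    have hV0 : V ≠ 0 := by
      rw [← norm_ne_zero_iff]
      linarith
    set x' := ‖V‖⁻¹ • V with hx'
    have hx'V : ‖(3 : ℝ) • x' - V‖ ≤ η := by
      rw [hx', norm_smul_normalize_sub hV0, abs_of_nonneg (by linarith)]
      linarith
    obtain ⟨w, hw, hwx, hwys⟩ := ih (fun z hz => hys z (List.mem_cons_of_mem _ hz)) x'
      (norm_inv_smul_self_eq_one hV0) η hη
    set N : ℝ := 3 ^ ys.length with hN
    have hN1 : 1 ≤ N := one_le_pow₀ (by norm_num)
    have hpow : (3 ^ (y :: ys).length : ℝ) = 3 * N := by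
      rw [List.length_cons, pow_succ, mul_comm]
    rw [hpow]
    have key : ∀ u r : E, u + r = V → ‖r‖ ≤ 2 → ‖(3 * N) • w - u‖ ≤ 3 * N - 1 + ε := by
      intro u r hur hr
      have e : (3 * N) • w - u = (3 : ℝ) • (N • w - x') + ((3 : ℝ) • x' - V) + r := by
        rw [← hur]; module
      have h1 := norm_add₃_le (a := (3 : ℝ) • (N • w - x')) (b := (3 : ℝ) • x' - V) (c := r)
      rw [norm_smul, Real.norm_of_nonneg (by norm_num : (0 : ℝ) ≤ 3)] at h1
      rw [e]
      linarith
    have mono : ∀ u : E, ‖N • w - u‖ ≤ N - 1 + η → ‖(3 * N) • w - u‖ ≤ 3 * N - 1 + ε := by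
      intro u hu
      have e : (3 * N) • w - u = (2 * N) • w + (N • w - u) := by module
      have h1 := norm_add_le ((2 * N) • w) (N • w - u)
      rw [norm_smul, hw, Real.norm_of_nonneg (by linarith)] at h1
      rw [e]
      linarith
    refine ⟨w, hw, ?_, fun z hz => ?_⟩
    · refine key x (s + s') (by rw [hV]; abel) ((norm_add_le _ _).trans (by linarith))
    · rcases List.mem_cons.mp hz with rfl | hz
      · refine ⟨s, s', t, hs, hs', ht, ht', ?_, ?_, by linarith⟩
        · exact key s (x + s') (by rw [hV]; abel) ((norm_add_le _ _).trans (by linarith))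
        · exact key s' (x + s) (by rw [hV]; abel) ((norm_add_le _ _).trans (by linarith))
      · obtain ⟨r, r', c, hr, hr', hc, hc', hwr, hwr', hzc⟩ := hwys z hz
        exact ⟨r, r', c, hr, hr', hc, hc', mono r hwr, mono r' hwr', by linarith⟩

theorem IsSphereIsometry_s16.abs_sub_le_of_decomposition {T : E → F} {R : F → E}
    (h : IsSphereIsometry_s16 T R) {f : F →L[ℝ] ℝ} {g : E →L[ℝ] ℝ} (hf : ∀ z, f z ≤ ‖z‖)
    (hg : ∀ z, g z ≤ ‖z‖) {y s s' : E} {t ε : ℝ} (hy : ‖y‖ = 1) (hs : ‖s‖ = 1) (hs' : ‖s'‖ = 1)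
    (ht : 0 ≤ t) (ht' : t ≤ 1) (hyt : ‖y - (t • s - (1 - t) • s')‖ ≤ ε)
    (hgs : 1 - ε ≤ g s) (hgs' : 1 - ε ≤ g s') (hfs : 1 - ε ≤ f (T s))
    (hfs' : 1 - ε ≤ f (-T (-s'))) : |f (T y) - g y| ≤ 4 * ε := by
  have hns' : ‖-s'‖ = 1 := by rw [norm_neg, hs']
  have hss' : ‖s + s'‖ ≤ 2 := (norm_add_le _ _).trans (by linarith)
  have hgs1 := hg s
  have hgs1' := hg s'
  rw [hs] at hgs1
  rw [hs'] at hgs1'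
  have hε : 0 ≤ ε := by linarith
  have g1 := hg (y - (t • s - (1 - t) • s'))
  have g2 := hg (-(y - (t • s - (1 - t) • s')))
  rw [norm_neg] at g2
  simp only [map_sub, map_neg, map_smul, smul_eq_mul] at g1 g2
  have f1 : 2 * t - 1 - 2 * ε ≤ f (T y) := by
    have h1 := hf (T s - T y)
    rw [h.norm_sub s y hs hy, norm_sub_rev, map_sub] at h1
    have e : y - s = (y - (t • s - (1 - t) • s')) - (1 - t) • (s + s') := by module
    have h2 := norm_sub_le (y - (t • s - (1 - t) • s')) ((1 - t) • (s + s'))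
    rw [← e, norm_smul, Real.norm_of_nonneg (by linarith)] at h2
    nlinarith
  have f2 : f (T y) ≤ 2 * t - 1 + 2 * ε := by
    have h1 := hf (T y - T (-s'))
    rw [h.norm_sub y (-s') hy hns', map_sub] at h1
    rw [map_neg] at hfs'
    have e : y - -s' = (y - (t • s - (1 - t) • s')) + t • (s + s') := by module
    have h2 := norm_add_le (y - (t • s - (1 - t) • s')) (t • (s + s'))
    rw [← e, norm_smul, Real.norm_of_nonneg ht] at h2
    nlinarith
  rw [abs_le]
  constructor <;> nlinarith

theorem IsSphereIsometry_s16.exists_almost_equal_functionals {T : E → F} {R : F → E}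
    (h : IsSphereIsometry_s16 T R) (hE : IsLush E) {x y₁ y₂ y₃ : E} (hx : ‖x‖ = 1) (h₁ : ‖y₁‖ = 1)
    (h₂ : ‖y₂‖ = 1) (h₃ : ‖y₃‖ = 1) {ε : ℝ} (hε : 0 < ε) :
    ∃ (f : F →L[ℝ] ℝ) (g : E →L[ℝ] ℝ), 1 - ε ≤ g x ∧ |f (T y₁) - g y₁| ≤ 4 * ε ∧
      |f (T y₂) - g y₂| ≤ 4 * ε ∧ |f (T y₃) - g y₃| ≤ 4 * ε := by
  obtain ⟨δ, hδ, H⟩ := h.exists_functional (N := 3 ^ 3) (by norm_num) 6 hε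
  obtain ⟨w, hw, hwx, hys⟩ := hE.exists_common_decomposition [y₁, y₂, y₃]
    (by simp [h₁, h₂, h₃]) x hx (min δ ε) (lt_min hδ hε)
  simp only [List.length_cons, List.length_nil, zero_add, Nat.reduceAdd] at hwx hys
  have hmδ := min_le_left δ ε
  have hmε := min_le_right δ ε
  obtain ⟨s₁, r₁, t₁, hs₁, hr₁, ht₁, ht₁', hws₁, hwr₁, hd₁⟩ := hys y₁ (by simp)
  obtain ⟨s₂, r₂, t₂, hs₂, hr₂, ht₂, ht₂', hws₂, hwr₂, hd₂⟩ := hys y₂ (by simp)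
  obtain ⟨s₃, r₃, t₃, hs₃, hr₃, ht₃, ht₃', hws₃, hwr₃, hd₃⟩ := hys y₃ (by simp)
  obtain ⟨g, hg, hgw⟩ := exists_norming_functional w
  obtain ⟨f, hf, hfl⟩ := H w
    [T s₁, -T (-r₁), T s₂, -T (-r₂), T s₃, -T (-r₃)] hw rfl (by
      simp only [List.forall_mem_cons, List.not_mem_nil, false_imp_iff, implies_true, and_true]
      exact ⟨⟨s₁, hs₁, by linarith, .inl rfl⟩, ⟨r₁, hr₁, by linarith, .inr rfl⟩,
        ⟨s₂, hs₂, by linarith, .inl rfl⟩, ⟨r₂, hr₂, by linarith, .inr rfl⟩,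
        ⟨s₃, hs₃, by linarith, .inl rfl⟩, ⟨r₃, hr₃, by linarith, .inr rfl⟩⟩)
  have hgu : ∀ u : E, ‖(3 ^ 3 : ℝ) • w - u‖ ≤ 3 ^ 3 - 1 + min δ ε → 1 - ε ≤ g u := by
    intro u hu
    have := hg ((3 ^ 3 : ℝ) • w - u)
    rw [map_sub, map_smul, hgw, hw, smul_eq_mul] at this
    linarith
  refine ⟨f, g, hgu x hwx, ?_, ?_, ?_⟩
  · exact h.abs_sub_le_of_decomposition hf hg h₁ hs₁ hr₁ ht₁ ht₁' (hd₁.trans hmε) (hgu _ hws₁)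
      (hgu _ hwr₁) (hfl _ (by simp)) (hfl _ (by simp))
  · exact h.abs_sub_le_of_decomposition hf hg h₂ hs₂ hr₂ ht₂ ht₂' (hd₂.trans hmε) (hgu _ hws₂)
      (hgu _ hwr₂) (hfl _ (by simp)) (hfl _ (by simp))
  · exact h.abs_sub_le_of_decomposition hf hg h₃ hs₃ hr₃ ht₃ ht₃' (hd₃.trans hmε) (hgu _ hws₃)
      (hgu _ hwr₃) (hfl _ (by simp)) (hfl _ (by simp))

/-- Linear relations between three vectors of `F` pull back to `E`. -/
theorem IsSphereIsometry_s16.add_eq_of_map_add_eq {T : E → F} {R : F → E}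
    (h : IsSphereIsometry_s16 T R) (hE : IsLush E) {y₁ y₂ y₃ : E} (h₁ : ‖y₁‖ = 1)
    (h₂ : ‖y₂‖ = 1) (h₃ : ‖y₃‖ = 1) {a b c : ℝ} (habc : a • T y₁ + b • T y₂ = c • T y₃) :
    a • y₁ + b • y₂ = c • y₃ := by
  by_contra hne
  set z := a • y₁ + b • y₂ - c • y₃ with hz
  have hz0 : z ≠ 0 := sub_ne_zero.mpr hne
  have hzpos : 0 < ‖z‖ := norm_pos_iff.mpr hz0
  set M := ‖z‖ + 4 * (|a| + |b| + |c|) with hM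
  have hMpos : 0 < M := by positivity
  obtain ⟨f, g, hgx, d₁, d₂, d₃⟩ := h.exists_almost_equal_functionals hE
    (norm_inv_smul_self_eq_one hz0) h₁ h₂ h₃ (ε := ‖z‖ / (2 * M)) (by positivity)
  set ε := ‖z‖ / (2 * M) with hε
  have hεM : ε * M = ‖z‖ / 2 := by rw [hε]; field_simp
  have hgz : ‖z‖ - ε * ‖z‖ ≤ g z := by
    rw [map_smul, smul_eq_mul, ← div_eq_inv_mul, le_div_iff₀ hzpos] at hgx
    linarith
  have hf0 : a * f (T y₁) + b * f (T y₂) - c * f (T y₃) = 0 := by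
    have := congrArg f habc
    simp only [map_add, map_smul, smul_eq_mul] at this
    linarith
  have hgz' : g z = a * g y₁ + b * g y₂ - c * g y₃ := by
    rw [hz]; simp
  have bound : ∀ r p q : ℝ, |p - q| ≤ 4 * ε → |r * (p - q)| ≤ |r| * (4 * ε) := fun r p q hpq => by
    rw [abs_mul]; exact mul_le_mul_of_nonneg_left hpq (abs_nonneg r)
  have b₁ := abs_le.mp (bound a _ _ d₁)
  have b₂ := abs_le.mp (bound b _ _ d₂)
  have b₃ := abs_le.mp (bound c _ _ d₃)
  rw [hM] at hεM
  nlinarith [b₁.1, b₂.1, b₃.2]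

theorem IsSphereIsometry_s16.exists_linearIsometryEquiv {T : E → F} {R : F → E}
    (h : IsSphereIsometry_s16 T R) (hE : IsLush E) :
    ∃ L : E ≃ₗᵢ[ℝ] F, ∀ x : E, ‖x‖ = 1 → L x = T x := by
  set U : F → E := fun v => ‖v‖ • R (‖v‖⁻¹ • v) with hU
  have hU0 : U 0 = 0 := by simp [hU]
  have hUnorm : ∀ v, ‖U v‖ = ‖v‖ := by
    intro v
    rcases eq_or_ne v 0 with rfl | hv
    · rw [hU0, norm_zero, norm_zero]
    · simp only [hU]
      rw [norm_smul, norm_norm, h.norm_inv _ (norm_inv_smul_self_eq_one hv), mul_one]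
  have hUT : ∀ (a : ℝ) (x : E), 0 ≤ a → ‖x‖ = 1 → U (a • T x) = a • x := by
    intro a x ha hx
    rcases ha.eq_or_lt with rfl | ha
    · rw [zero_smul, zero_smul, hU0]
    · have : ‖a • T x‖ = a := by
        rw [norm_smul, h.norm_map x hx, mul_one, Real.norm_of_nonneg ha.le]
      simp only [hU]
      rw [this, smul_smul, inv_mul_cancel₀ ha.ne', one_smul, h.left_inv x hx]
  have hUadd : ∀ p q, U (p + q) = U p + U q := by
    intro p q
    by_cases hF : ∃ x : F, x ≠ 0
    · obtain ⟨x₀, hx₀⟩ := hF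
      have hrep : ∀ v : F, ∃ y : E, ‖y‖ = 1 ∧ ‖v‖ • T y = v := by
        intro v
        rcases eq_or_ne v 0 with rfl | hv
        · exact ⟨R (‖x₀‖⁻¹ • x₀), h.norm_inv _ (norm_inv_smul_self_eq_one hx₀), by simp⟩
        · refine ⟨R (‖v‖⁻¹ • v), h.norm_inv _ (norm_inv_smul_self_eq_one hv), ?_⟩
          rw [h.right_inv _ (norm_inv_smul_self_eq_one hv), smul_smul,
            mul_inv_cancel₀ (norm_ne_zero_iff.mpr hv), one_smul]
      obtain ⟨y₁, h₁, e₁⟩ := hrep p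
      obtain ⟨y₂, h₂, e₂⟩ := hrep q
      obtain ⟨y₃, h₃, e₃⟩ := hrep (p + q)
      have u₁ := hUT ‖p‖ y₁ (norm_nonneg _) h₁
      have u₂ := hUT ‖q‖ y₂ (norm_nonneg _) h₂
      have u₃ := hUT ‖p + q‖ y₃ (norm_nonneg _) h₃
      rw [e₁] at u₁
      rw [e₂] at u₂
      rw [e₃] at u₃
      rw [u₁, u₂, u₃]
      exact (h.add_eq_of_map_add_eq hE h₁ h₂ h₃ (by rw [e₁, e₂, e₃])).symm
    · push Not at hF
      rw [hF p, hF q, add_zero, hU0, add_zero]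
  let A : F →+ E := ⟨⟨U, hU0⟩, hUadd⟩
  have hAcont : Continuous A :=
    (AddMonoidHomClass.isometry_of_norm A hUnorm).continuous
  let B : F →ₗᵢ[ℝ] E := ⟨(A.toRealLinearMap hAcont).toLinearMap, hUnorm⟩
  have hB : ∀ v, B v = U v := fun _ => rfl
  have hBsurj : Function.Surjective B := by
    intro e
    rcases eq_or_ne e 0 with rfl | he
    · exact ⟨0, map_zero B⟩
    · refine ⟨‖e‖ • T (‖e‖⁻¹ • e), ?_⟩
      rw [hB, hUT _ _ (norm_nonneg _) (norm_inv_smul_self_eq_one he), smul_smul,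
        mul_inv_cancel₀ (norm_ne_zero_iff.mpr he), one_smul]
  refine ⟨(LinearIsometryEquiv.ofSurjective B hBsurj).symm, fun x hx => ?_⟩
  rw [LinearIsometryEquiv.symm_apply_eq]
  have := hUT 1 x zero_le_one hx
  rw [one_smul, one_smul] at this
  exact this.symm

end Lush

/-- Corollary 3.8: every lush space has the Mazur–Ulam property. -/
theorem stmt_16 {E F : Type*} [NormedAddCommGroup E] [NormedSpace ℝ E] [CompleteSpace E]
    [NormedAddCommGroup F] [NormedSpace ℝ F] [CompleteSpace F]
    (hE : IsLush E) (T : E → F)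
    (hmap : ∀ x : E, ‖x‖ = 1 → ‖T x‖ = 1)
    (hsurj : ∀ z : F, ‖z‖ = 1 → ∃ x : E, ‖x‖ = 1 ∧ T x = z)
    (hiso : ∀ x y : E, ‖x‖ = 1 → ‖y‖ = 1 → ‖T x - T y‖ = ‖x - y‖) :
    ∃ L : E ≃ₗᵢ[ℝ] F, ∀ x : E, ‖x‖ = 1 → L x = T x := by
  have hinv : ∀ z : F, ∃ x : E, ‖z‖ = 1 → ‖x‖ = 1 ∧ T x = z := by
    intro z
    by_cases hz : ‖z‖ = 1
    · obtain ⟨x, hx⟩ := hsurj z hz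
      exact ⟨x, fun _ => hx⟩
    · exact ⟨0, fun hz' => absurd hz' hz⟩
  choose R hR using hinv
  have h : IsSphereIsometry_s16 T R :=
    { norm_map := hmap
      norm_inv := fun z hz => (hR z hz).1
      right_inv := fun z hz => (hR z hz).2
      norm_sub := hiso
      left_inv := fun x hx => by
        obtain ⟨h1, h2⟩ := hR (T x) (hmap x hx)
        have := hiso (R (T x)) x h1 hx
        rw [h2, sub_self, norm_zero] at this
        exact sub_eq_zero.mp (norm_eq_zero.mp this.symm) }
  exact h.exists_linearIsometryEquiv hE
end
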